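/- Let T be an ℝ-tree and let G be a group with a non-nesting action on T by weak homeomorphisms. If g ∈ G is loxodromic with axis L_g, then for every p ∈ T the segment [p, g(p)] meets L_g, and [p, g(p)] ∩ L_g = [q, g(q)] for some q ∈ L_g. -/

import Mathlib

open Set

/-- A topologically embedded arc in `T` joining `x` to `y`, given as a subset:
the image of a continuous injective map on `[0,1]` with endpoints `x` and `y`
(such a map is automatically a topological embedding). -/
def IsArc {T : Type*} [MetricSpace T] (A : Set T) (x y : T) : Prop :=
  ∃ f : ℝ → T, ContinuousOn f (Icc (0 : ℝ) 1) ∧ InjOn f (Icc (0 : ℝ) 1) ∧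
    f '' Icc (0 : ℝ) 1 = A ∧ f 0 = x ∧ f 1 = y

/-- `A ⊆ T` is isometric to a closed bounded interval of `ℝ`. -/
def IsIsometricToInterval {T : Type*} [MetricSpace T] (A : Set T) : Prop :=
  ∃ (a b : ℝ) (f : ℝ → T), a ≤ b ∧
    (∀ s ∈ Icc a b, ∀ t ∈ Icc a b, dist (f s) (f t) = |s - t|) ∧
    f '' Icc a b = A

/-- An `ℝ`-tree: a metric space in which any two distinct points are joined by a
unique topologically embedded arc, and this arc is isometric to a closed bounded
interval of `ℝ`. -/
structure IsRTree (T : Type*) [MetricSpace T] : Prop where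
  arc_existsUnique : ∀ ⦃x y : T⦄, x ≠ y → ∃! A : Set T, IsArc A x y
  arc_isometric : ∀ ⦃x y : T⦄, x ≠ y → ∀ A : Set T, IsArc A x y → IsIsometricToInterval A

open scoped Classical in
/-- The segment `[x,y]`: the unique arc joining `x` to `y` if `x ≠ y`
(computed as the intersection of all such arcs), and `{x}` if `x = y`. -/
noncomputable def seg {T : Type*} [MetricSpace T] (x y : T) : Set T :=
  if x = y then {x} else ⋂₀ {A : Set T | IsArc A x y}

/-- Betweenness: `Btwn x y z` iff `x ∈ [y,z] \ {y,z}`. -/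
def Btwn {T : Type*} [MetricSpace T] (x y z : T) : Prop :=
  x ∈ seg y z ∧ x ≠ y ∧ x ≠ z

/-- A weak homeomorphism of `T`: a bijection preserving the betweenness relation. -/
def IsWeakHomeo {T : Type*} [MetricSpace T] (g : T → T) : Prop :=
  Function.Bijective g ∧ ∀ x y z : T, Btwn x y z ↔ Btwn (g x) (g y) (g z)

/-- Convex subsets (subtrees) of `T`. -/
def ConvexSubtree {T : Type*} [MetricSpace T] (S : Set T) : Prop :=
  ∀ x ∈ S, ∀ y ∈ S, seg x y ⊆ S

/-- The action of `G` on `T` is by weak homeomorphisms. -/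
def ActsByWeakHomeos (G T : Type*) [Group G] [MulAction G T] [MetricSpace T] : Prop :=
  ∀ g : G, IsWeakHomeo (fun t : T => g • t)

/-- The action of `G` on `T` is non-nesting: no segment is mapped properly into itself. -/
def NonNesting (G T : Type*) [Group G] [MulAction G T] [MetricSpace T] : Prop :=
  ∀ (g : G) (x y : T), ¬ ((fun t : T => g • t) '' seg x y ⊂ seg x y)

/-- The fixed-point set `T^g` of a group element. -/
def fixedSet (T : Type*) {G : Type*} [Group G] [MulAction G T] (g : G) : Set T :=
  {t : T | g • t = t}

/-- `x, y, z` span a tripod: the median of `x, y, z` lies in none of `{x,y,z}`. -/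
def IsTripod {T : Type*} [MetricSpace T] (x y z : T) : Prop :=
  ∀ c ∈ seg x y ∩ seg y z ∩ seg z x, c ≠ x ∧ c ≠ y ∧ c ≠ z

/-- `S` contains no tripod. -/
def NoTripod {T : Type*} [MetricSpace T] (S : Set T) : Prop :=
  ¬ ∃ x y z : T, IsTripod x y z ∧ seg x y ∪ seg y z ∪ seg z x ⊆ S

/-- A line: a convex subset containing no tripod, maximal for inclusion. -/
def IsLine {T : Type*} [MetricSpace T] (L : Set T) : Prop :=
  ConvexSubtree L ∧ NoTripod L ∧
    ∀ L' : Set T, ConvexSubtree L' → NoTripod L' → L ⊆ L' → L' = L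

/-- `L` is an axis for `g`: a `g`-invariant line. -/
def IsAxis {G T : Type*} [Group G] [MulAction G T] [MetricSpace T] (g : G) (L : Set T) :
    Prop :=
  IsLine L ∧ (fun t : T => g • t) '' L = L


/-- Reparametrization: an injective path on any interval gives an arc. -/
theorem isArc_of_path {T : Type*} [MetricSpace T] {a b : ℝ} (hab : a < b) {f : ℝ → T}
    (hc : ContinuousOn f (Icc a b)) (hi : InjOn f (Icc a b)) :
    IsArc (f '' Icc a b) (f a) (f b) := by
  have hmap : MapsTo (fun t : ℝ => a + t * (b - a)) (Icc 0 1) (Icc a b) := by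
    intro t ht
    have h1 := ht.1
    have h2 := ht.2
    constructor <;> simp only <;> nlinarith
  refine ⟨fun t => f (a + t * (b - a)), ?_, ?_, ?_, ?_, ?_⟩
  · exact hc.comp (by fun_prop) hmap
  · intro s hs t ht h
    have h1 := hi (hmap hs) (hmap ht) h
    have h2 : (b - a) ≠ 0 := by linarith
    simp only at h1
    have h3 : s * (b - a) = t * (b - a) := by linarith
    exact mul_right_cancel₀ h2 h3
  · ext z
    constructor
    · rintro ⟨t, ht, rfl⟩
      exact ⟨_, hmap ht, rfl⟩
    · rintro ⟨t, ht, rfl⟩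
      have hpos : 0 < b - a := by linarith
      refine ⟨(t - a) / (b - a), ⟨div_nonneg (by linarith [ht.1]) hpos.le, ?_⟩, ?_⟩
      · rw [div_le_one hpos]
        linarith [ht.2]
      · simp only
        congr 1
        field_simp
        ring
  · simp
  · simp

theorem seg_eq_of_isArc {T : Type*} [MetricSpace T] (hT : IsRTree T) {x y : T} (hxy : x ≠ y)
    {A : Set T} (hA : IsArc A x y) : seg x y = A := by
  unfold seg
  rw [if_neg hxy]
  obtain ⟨B, hB, hu⟩ := hT.arc_existsUnique hxy
  apply Subset.antisymm
  · exact sInter_subset_of_mem hA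
  · apply subset_sInter
    intro C hC
    rw [hu A hA, hu C hC]

theorem continuousOn_of_iso {T : Type*} [MetricSpace T] {a b : ℝ} {f : ℝ → T}
    (hf : ∀ s ∈ Icc a b, ∀ t ∈ Icc a b, dist (f s) (f t) = |s - t|) :
    ContinuousOn f (Icc a b) := by
  have : LipschitzOnWith 1 f (Icc a b) := by
    apply LipschitzOnWith.of_dist_le_mul
    intro s hs t ht
    rw [hf s hs t ht, Real.dist_eq]
    simp
  exact this.continuousOn

theorem injOn_of_iso {T : Type*} [MetricSpace T] {a b : ℝ} {f : ℝ → T}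
    (hf : ∀ s ∈ Icc a b, ∀ t ∈ Icc a b, dist (f s) (f t) = |s - t|) :
    InjOn f (Icc a b) := by
  intro s hs t ht h
  have := hf s hs t ht
  rw [h, dist_self] at this
  have := abs_eq_zero.1 this.symm
  linarith

/-- Every segment is a geodesic. -/
theorem exists_geod {T : Type*} [MetricSpace T] (hT : IsRTree T) (x y : T) :
    ∃ γ : ℝ → T, (∀ s ∈ Icc 0 (dist x y), ∀ t ∈ Icc 0 (dist x y), dist (γ s) (γ t) = |s - t|) ∧
      γ 0 = x ∧ γ (dist x y) = y ∧ γ '' Icc 0 (dist x y) = seg x y := by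
  by_cases hxy : x = y
  · subst hxy
    refine ⟨fun _ => x, ?_, rfl, rfl, ?_⟩
    · simp only [dist_self, Icc_self, mem_singleton_iff]
      rintro s rfl t rfl
      simp
    · simp [seg]
  obtain ⟨A, hA, -⟩ := hT.arc_existsUnique hxy
  have hseg := seg_eq_of_isArc hT hxy hA
  obtain ⟨a, b, f, hab, hf, hfA⟩ := hT.arc_isometric hxy A hA
  have hxA : x ∈ A := by
    obtain ⟨h, -, -, h3, h4, -⟩ := hA
    rw [← h3, ← h4]
    exact ⟨0, by simp, rfl⟩
  have hyA : y ∈ A := by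
    obtain ⟨h, -, -, h3, -, h4⟩ := hA
    rw [← h3, ← h4]
    exact ⟨1, by simp, rfl⟩
  rw [← hfA] at hxA hyA
  obtain ⟨s, hs, rfl⟩ := hxA
  obtain ⟨t, ht, rfl⟩ := hyA
  have hst : s ≠ t := fun h => hxy (by rw [h])
  have hd := hf s hs t ht
  rcases lt_or_gt_of_ne hst with hlt | hlt
  · have hd' : dist (f s) (f t) = t - s := by
      rw [hd, abs_of_neg (by linarith)]; ring
    have key : ∀ u ∈ Icc 0 (t - s), ∀ v ∈ Icc 0 (t - s), dist (f (s + u)) (f (s + v)) = |u - v| := by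
      intro u hu v hv
      rw [hf _ ⟨by linarith [hs.1, hu.1], by linarith [ht.2, hu.2]⟩ _
        ⟨by linarith [hs.1, hv.1], by linarith [ht.2, hv.2]⟩]
      congr 1
      ring
    rw [hd']
    refine ⟨fun u => f (s + u), key, by simp, by simp, ?_⟩
    have := isArc_of_path (f := fun u => f (s + u)) (sub_pos.2 hlt)
      (continuousOn_of_iso key) (injOn_of_iso key)
    simp only [add_zero, add_sub_cancel] at this
    exact (seg_eq_of_isArc hT hxy this).symm
  · have hd' : dist (f s) (f t) = s - t := by
      rw [hd, abs_of_pos (by linarith)]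
    have key : ∀ u ∈ Icc 0 (s - t), ∀ v ∈ Icc 0 (s - t), dist (f (s - u)) (f (s - v)) = |u - v| := by
      intro u hu v hv
      rw [hf _ ⟨by linarith [ht.1, hu.2], by linarith [hs.2, hu.1]⟩ _
        ⟨by linarith [ht.1, hv.2], by linarith [hs.2, hv.1]⟩, abs_sub_comm]
      congr 1
      ring
    rw [hd']
    refine ⟨fun u => f (s - u), key, by simp, by simp, ?_⟩
    have := isArc_of_path (f := fun u => f (s - u)) (sub_pos.2 hlt)
      (continuousOn_of_iso key) (injOn_of_iso key)
    simp only [sub_zero, sub_sub_cancel] at this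
    exact (seg_eq_of_isArc hT hxy this).symm

theorem dist_of_mem_seg {T : Type*} [MetricSpace T] (hT : IsRTree T) {x y z : T}
    (h : z ∈ seg x y) : dist x z + dist z y = dist x y := by
  obtain ⟨γ, h1, h2, h3, h4⟩ := exists_geod hT x y
  rw [← h4] at h
  obtain ⟨t, ht, rfl⟩ := h
  have e1 := h1 0 ⟨le_rfl, dist_nonneg⟩ t ht
  have e2 := h1 t ht _ ⟨dist_nonneg, le_rfl⟩
  rw [h2] at e1
  rw [h3] at e2
  rw [e1, e2, abs_of_nonpos (by linarith [ht.1]), abs_of_nonpos (by linarith [ht.2])]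
  ring

theorem left_mem_seg {T : Type*} [MetricSpace T] (hT : IsRTree T) (x y : T) : x ∈ seg x y := by
  obtain ⟨γ, h1, h2, h3, h4⟩ := exists_geod hT x y
  rw [← h4]
  exact ⟨0, ⟨le_rfl, dist_nonneg⟩, h2⟩

theorem right_mem_seg {T : Type*} [MetricSpace T] (hT : IsRTree T) (x y : T) : y ∈ seg x y := by
  obtain ⟨γ, h1, h2, h3, h4⟩ := exists_geod hT x y
  rw [← h4]
  exact ⟨_, ⟨dist_nonneg, le_rfl⟩, h3⟩

/-- Concatenation of two segments meeting only at the common endpoint. -/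
theorem mem_seg_of_inter {T : Type*} [MetricSpace T] (hT : IsRTree T) {x m z : T}
    (h : ∀ c, c ∈ seg x m → c ∈ seg m z → c = m) : m ∈ seg x z := by
  by_cases hxm : x = m
  · subst hxm; exact left_mem_seg hT _ _
  by_cases hmz : m = z
  · subst hmz; exact right_mem_seg hT _ _
  obtain ⟨α, a1, a2, a3, a4⟩ := exists_geod hT x m
  obtain ⟨β, b1, b2, b3, b4⟩ := exists_geod hT m z
  have hp : 0 < dist x m := dist_pos.2 hxm
  have hq : 0 < dist m z := dist_pos.2 hmz
  set p := dist x m with hpdef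
  set q := dist m z with hqdef
  have hxz : x ≠ z := by
    rintro rfl
    exact hxm (h x (left_mem_seg hT _ _) (right_mem_seg hT _ _))
  let f : ℝ → T := fun t => if t ≤ p then α t else β (t - p)
  have hfα : ∀ t, t ≤ p → f t = α t := fun t ht => if_pos ht
  have hfβ : ∀ t, p ≤ t → f t = β (t - p) := by
    intro t ht
    rcases ht.eq_or_lt with rfl | ht
    · rw [hfα _ le_rfl, sub_self, a3, b2]
    · exact if_neg (not_le.2 ht)
  have hcont : ContinuousOn f (Icc 0 (p + q)) := by
    have : Icc 0 (p + q) = Icc 0 p ∪ Icc p (p + q) :=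
      (Icc_union_Icc_eq_Icc hp.le (by linarith)).symm
    rw [this]
    apply ContinuousOn.union_of_isClosed _ _ isClosed_Icc isClosed_Icc
    · exact (continuousOn_of_iso a1).congr (fun t ht => hfα t ht.2)
    · have : ContinuousOn (fun t => β (t - p)) (Icc p (p + q)) :=
        (continuousOn_of_iso b1).comp (by fun_prop)
          (fun t ht => ⟨by linarith [ht.1], by linarith [ht.2]⟩)
      exact this.congr (fun t ht => hfβ t ht.1)
  have hcross : ∀ s ∈ Icc 0 (p + q), ∀ t ∈ Icc 0 (p + q), s ≤ p → p ≤ t → f s = f t → s = t := by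
    intro s hs t ht hsp hpt he
    rw [hfα s hsp, hfβ t hpt] at he
    have hs' : s ∈ Icc 0 p := ⟨hs.1, hsp⟩
    have ht' : t - p ∈ Icc 0 q := ⟨by linarith, by linarith [ht.2]⟩
    have hm : α s = m := by
      apply h
      · rw [← a4]; exact ⟨s, hs', rfl⟩
      · rw [← b4, he]; exact ⟨_, ht', rfl⟩
    have e1 : s = p := injOn_of_iso a1 hs' ⟨hp.le, le_rfl⟩ (by rw [hm, a3])
    have e2 : t - p = 0 := injOn_of_iso b1 ht' ⟨le_rfl, hq.le⟩ (by rw [← he, hm, b2])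
    linarith
  have hinj : InjOn f (Icc 0 (p + q)) := by
    intro s hs t ht he
    rcases le_total s p with hsp | hsp <;> rcases le_total t p with htp | htp
    · rw [hfα s hsp, hfα t htp] at he
      exact injOn_of_iso a1 ⟨hs.1, hsp⟩ ⟨ht.1, htp⟩ he
    · exact hcross s hs t ht hsp htp he
    · exact (hcross t ht s hs htp hsp he.symm).symm
    · rw [hfβ s hsp, hfβ t htp] at he
      have := injOn_of_iso b1 ⟨by linarith, by linarith [hs.2]⟩ ⟨by linarith, by linarith [ht.2]⟩ he
      linarith
  have harc := isArc_of_path (by linarith : (0 : ℝ) < p + q) hcont hinj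
  have e0 : f 0 = x := by rw [hfα 0 hp.le, a2]
  have e1 : f (p + q) = z := by
    rw [hfβ _ (by linarith)]
    simpa using b3
  rw [e0, e1] at harc
  rw [seg_eq_of_isArc hT hxz harc]
  exact ⟨p, ⟨hp.le, by linarith⟩, by rw [hfα p le_rfl, a3]⟩

theorem mem_seg_iff {T : Type*} [MetricSpace T] (hT : IsRTree T) {x y z : T} :
    z ∈ seg x y ↔ dist x z + dist z y = dist x y := by
  refine ⟨dist_of_mem_seg hT, fun h => mem_seg_of_inter hT ?_⟩
  intro c h1 h2
  have e1 := dist_of_mem_seg hT h1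
  have e2 := dist_of_mem_seg hT h2
  have := dist_triangle x c y
  rw [dist_comm z c] at e2
  have h0 : dist c z ≤ 0 := by linarith
  exact dist_le_zero.1 h0

theorem seg_symm {T : Type*} [MetricSpace T] (hT : IsRTree T) (x y : T) : seg x y = seg y x := by
  ext z
  rw [mem_seg_iff hT, mem_seg_iff hT, dist_comm x z, dist_comm z y, dist_comm x y, add_comm]

/-- Sub-segments at the left end. -/
theorem seg_sub_left {T : Type*} [MetricSpace T] (hT : IsRTree T) {x y z c : T}
    (hz : z ∈ seg x y) (hc : c ∈ seg x z) : c ∈ seg x y := by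
  rw [mem_seg_iff hT] at *
  linarith [dist_triangle x c y, dist_triangle c z y]

theorem seg_sub_right {T : Type*} [MetricSpace T] (hT : IsRTree T) {x y z c : T}
    (hz : z ∈ seg x y) (hc : c ∈ seg z y) : c ∈ seg x y := by
  rw [mem_seg_iff hT] at *
  linarith [dist_triangle x c y, dist_triangle x z c]

/-- If `z ∈ [x,y]` and `c ∈ [x,z]` then `z ∈ [c,y]`. -/
theorem seg_swap {T : Type*} [MetricSpace T] (hT : IsRTree T) {x y z c : T}
    (hz : z ∈ seg x y) (hc : c ∈ seg x z) : z ∈ seg c y := by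
  rw [mem_seg_iff hT] at *
  linarith [dist_triangle x c y, dist_triangle c z y]

theorem seg_dist {T : Type*} [MetricSpace T] (hT : IsRTree T) {x y u v : T}
    (hu : u ∈ seg x y) (hv : v ∈ seg x y) : dist u v = |dist x u - dist x v| := by
  obtain ⟨γ, h1, h2, h3, h4⟩ := exists_geod hT x y
  rw [← h4] at hu hv
  obtain ⟨s, hs, rfl⟩ := hu
  obtain ⟨t, ht, rfl⟩ := hv
  have h0 : (0 : ℝ) ∈ Icc 0 (dist x y) := ⟨le_rfl, dist_nonneg⟩
  have e1 := h1 0 h0 s hs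
  have e2 := h1 0 h0 t ht
  rw [h2, abs_of_nonpos (by linarith [hs.1])] at e1
  rw [h2, abs_of_nonpos (by linarith [ht.1])] at e2
  rw [h1 s hs t ht, e1, e2]
  congr 1
  ring

theorem seg_split {T : Type*} [MetricSpace T] (hT : IsRTree T) {x y u v : T}
    (hu : u ∈ seg x y) (hv : v ∈ seg x y) : u ∈ seg x v ∨ u ∈ seg v y := by
  have h := seg_dist hT hu hv
  rw [mem_seg_iff hT] at hu hv ⊢
  rw [mem_seg_iff hT]
  rcases le_total (dist x u) (dist x v) with hle | hle
  · rw [abs_of_nonpos (by linarith)] at h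
    left; linarith
  · rw [abs_of_nonneg (by linarith)] at h
    right; rw [dist_comm v u]; linarith

theorem exists_median {T : Type*} [MetricSpace T] (hT : IsRTree T) (x y z : T) :
    ∃ m, m ∈ seg x y ∧ m ∈ seg y z ∧ m ∈ seg x z := by
  have hcomp : IsCompact (seg x y) := by
    obtain ⟨γ, h1, h2, h3, h4⟩ := exists_geod hT x y
    rw [← h4]
    exact isCompact_Icc.image_of_continuousOn (continuousOn_of_iso h1)
  obtain ⟨m, hm, hmin⟩ := hcomp.exists_isMinOn ⟨x, left_mem_seg hT x y⟩
    (f := fun t => dist t z) (by fun_prop)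
  have key : ∀ c, c ∈ seg x y → c ∈ seg m z → c = m := by
    intro c hc hcm
    have h1 : dist m z ≤ dist c z := hmin hc
    have h2 := dist_of_mem_seg hT hcm
    have : dist m c ≤ 0 := by linarith
    exact (dist_le_zero.1 this).symm
  refine ⟨m, hm, ?_, ?_⟩
  · apply mem_seg_of_inter hT
    intro c hc
    apply key
    rw [seg_symm hT] at hc
    exact seg_sub_right hT hm hc
  · apply mem_seg_of_inter hT
    intro c hc
    exact key c (seg_sub_left hT hm hc)

theorem seg_subset_union {T : Type*} [MetricSpace T] (hT : IsRTree T) {x z c : T} (y : T)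
    (hc : c ∈ seg x z) : c ∈ seg x y ∨ c ∈ seg y z := by
  obtain ⟨m, h1, h2, h3⟩ := exists_median hT x y z
  rcases seg_split hT hc h3 with h | h
  · exact Or.inl (seg_sub_left hT h1 h)
  · exact Or.inr (seg_sub_right hT h2 h)

theorem exists_mid_seg {T : Type*} [MetricSpace T] (hT : IsRTree T) {x y : T} (hxy : x ≠ y) :
    ∃ c ∈ seg x y, c ≠ x ∧ c ≠ y := by
  obtain ⟨γ, h1, h2, h3, h4⟩ := exists_geod hT x y
  have hp := dist_pos.2 hxy
  have hm : dist x y / 2 ∈ Icc 0 (dist x y) := ⟨by linarith, by linarith⟩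
  refine ⟨γ (dist x y / 2), h4 ▸ ⟨_, hm, rfl⟩, ?_, ?_⟩
  · intro h
    have := injOn_of_iso h1 hm ⟨le_rfl, hp.le⟩ (h.trans h2.symm)
    linarith
  · intro h
    have := injOn_of_iso h1 hm ⟨hp.le, le_rfl⟩ (h.trans h3.symm)
    linarith

/-- The median is unique. -/
theorem median_unique {T : Type*} [MetricSpace T] (hT : IsRTree T) {x y z m c : T}
    (m1 : m ∈ seg x y) (m2 : m ∈ seg y z) (m3 : m ∈ seg x z)
    (c1 : c ∈ seg x y) (c2 : c ∈ seg y z) (c3 : c ∈ seg x z) : c = m := by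
  have h := seg_dist hT c1 m1
  rw [mem_seg_iff hT] at *
  have e : dist x c = dist x m := by
    rw [dist_comm c y] at c1
    rw [dist_comm m y] at m1
    linarith
  rw [e, sub_self, abs_zero] at h
  exact dist_eq_zero.1 h

theorem IsTripod.rot {T : Type*} [MetricSpace T] {x y z : T} (h : IsTripod x y z) :
    IsTripod y z x := by
  intro c hc
  obtain ⟨h1, h2, h3⟩ := h c ⟨⟨hc.2, hc.1.1⟩, hc.1.2⟩
  exact ⟨h2, h3, h1⟩

/-- A line contains the limits of its half-open segments. -/
theorem line_closed {T : Type*} [MetricSpace T] (hT : IsRTree T) {L : Set T} (hL : IsLine L)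
    {a q : T} (ha : a ∈ L) (h : ∀ c ∈ seg a q, c ≠ q → c ∈ L) : q ∈ L := by
  obtain ⟨hconv, hnt, hmax⟩ := hL
  have hx : ∀ x ∈ L, ∀ c ∈ seg x q, c ≠ q → c ∈ L := by
    intro x hx c hc hcq
    rcases seg_subset_union hT a hc with h' | h'
    · exact hconv x hx a ha h'
    · exact h c h' hcq
  have hnt' : ∀ x ∈ L, ∀ y ∈ L, ¬ IsTripod x y q := by
    intro x hxL y hyL ht
    obtain ⟨m, m1, m2, m3⟩ := exists_median hT x y q
    obtain ⟨n1, n2, n3⟩ := ht m ⟨⟨m1, m2⟩, by rw [seg_symm hT]; exact m3⟩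
    obtain ⟨r, r1, r2, r3⟩ := exists_mid_seg hT n3
    have rx : r ∈ seg x q := seg_sub_right hT m3 r1
    have ry : r ∈ seg y q := seg_sub_right hT m2 r1
    have rL : r ∈ L := hx x hxL r rx r3
    refine hnt ⟨x, y, r, ?_, ?_⟩
    · rintro c ⟨⟨c1, c2⟩, c3⟩
      rw [seg_symm hT] at c3
      have c2' := seg_sub_left hT ry c2
      have c3' := seg_sub_left hT rx c3
      have e := median_unique hT m1 m2 m3 c1 c2' c3'
      subst e
      exact ⟨n1, n2, r2.symm⟩
    · exact union_subset (union_subset (hconv x hxL y hyL) (hconv y hyL r rL)) (hconv r rL x hxL)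
  have hdeg : ∀ z, ¬ IsTripod q q z := by
    intro z ht
    exact (ht q ⟨⟨left_mem_seg hT _ _, left_mem_seg hT _ _⟩, right_mem_seg hT _ _⟩).1 rfl
  have := hmax (insert q L) ?_ ?_ (subset_insert _ _)
  · rw [← this]; exact mem_insert _ _
  · rintro x (rfl | hxL) y (rfl | hyL) c hc
    · left
      simpa [seg] using hc
    · by_cases hcq : c = x
      · exact Or.inl hcq
      · rw [seg_symm hT] at hc
        exact Or.inr (hx y hyL c hc hcq)
    · by_cases hcq : c = y
      · exact Or.inl hcq
      · exact Or.inr (hx x hxL c hc hcq)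
    · exact Or.inr (hconv x hxL y hyL hc)
  · rintro ⟨x, y, z, ht, hsub⟩
    have hxI : x ∈ insert q L := hsub (Or.inl (Or.inl (left_mem_seg hT _ _)))
    have hyI : y ∈ insert q L := hsub (Or.inl (Or.inl (right_mem_seg hT _ _)))
    have hzI : z ∈ insert q L := hsub (Or.inr (left_mem_seg hT _ _))
    rcases hxI with rfl | hxL <;> rcases hyI with rfl | hyL <;> rcases hzI with rfl | hzL
    · exact hdeg _ ht
    · exact hdeg _ ht
    · exact hdeg _ ht.rot.rot
    · exact hnt' _ hyL _ hzL ht.rot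
    · exact hdeg _ ht.rot
    · exact hnt' _ hzL _ hxL ht.rot.rot
    · exact hnt' _ hxL _ hyL ht
    · exact hnt ⟨x, y, z, ht, union_subset (union_subset (hconv x hxL y hyL)
        (hconv y hyL z hzL)) (hconv z hzL x hxL)⟩

/-- Projection of a point to a line. -/
theorem exists_proj {T : Type*} [MetricSpace T] (hT : IsRTree T) {L : Set T} (hL : IsLine L)
    (p : T) : ∃ q ∈ L, ∀ c ∈ seg p q, c ∈ L → c = q := by
  have hne : L.Nonempty := by
    by_contra hE
    rw [not_nonempty_iff_eq_empty] at hE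
    have hss : ∀ c ∈ seg p p, c = p := by
      intro c hc
      simpa [seg] using hc
    have := hL.2.2 {p} ?_ ?_ (by rw [hE]; exact empty_subset _)
    · rw [hE] at this
      exact singleton_ne_empty p this
    · rintro x rfl y rfl c hc
      exact hss c hc
    · rintro ⟨x, y, z, ht, hsub⟩
      have h1 : x = p := hsub (Or.inl (Or.inl (left_mem_seg hT _ _)))
      have h2 : y = p := hsub (Or.inl (Or.inl (right_mem_seg hT _ _)))
      have h3 : z = p := hsub (Or.inr (left_mem_seg hT _ _))
      subst h1; subst h2; subst h3
      exact (ht _ ⟨⟨left_mem_seg hT _ _, left_mem_seg hT _ _⟩, left_mem_seg hT _ _⟩).1 rfl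
  obtain ⟨a, ha⟩ := hne
  obtain ⟨γ, h1, h2, h3, h4⟩ := exists_geod hT a p
  have h0 : (0 : ℝ) ∈ Icc 0 (dist a p) := ⟨le_rfl, dist_nonneg⟩
  have hD : dist a p ∈ Icc 0 (dist a p) := ⟨dist_nonneg, le_rfl⟩
  have hda : ∀ t ∈ Icc 0 (dist a p), dist a (γ t) = t := by
    intro t ht
    have := h1 0 h0 t ht
    rw [h2] at this
    rw [this, abs_of_nonpos (by linarith [ht.1])]; ring
  let S : Set ℝ := {t | t ∈ Icc 0 (dist a p) ∧ γ t ∈ L}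
  have hS0 : (0 : ℝ) ∈ S := ⟨h0, by rw [h2]; exact ha⟩
  have hSb : BddAbove S := ⟨dist a p, fun t ht => ht.1.2⟩
  set s := sSup S with hs
  have hsI : s ∈ Icc 0 (dist a p) := ⟨le_csSup hSb hS0, csSup_le ⟨0, hS0⟩ fun t ht => ht.1.2⟩
  have hq : γ s ∈ seg a p := h4 ▸ ⟨s, hsI, rfl⟩
  have hqL : γ s ∈ L := by
    apply line_closed hT hL ha
    intro c hc hcq
    have hcp := seg_sub_left hT hq hc
    rw [← h4] at hcp
    obtain ⟨t, ht, rfl⟩ := hcp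
    have hts : t < s := by
      have e := dist_of_mem_seg hT hc
      rw [hda t ht, hda s hsI] at e
      linarith [dist_pos.2 hcq]
    obtain ⟨u, hu, htu⟩ := exists_lt_of_lt_csSup ⟨0, hS0⟩ hts
    apply hL.1 a ha (γ u) hu.2
    rw [mem_seg_iff hT, hda t ht, hda u hu.1, h1 t ht u hu.1, abs_of_neg (by linarith)]
    ring
  refine ⟨γ s, hqL, ?_⟩
  intro c hc hcL
  rw [seg_symm hT] at hc
  have hcp := seg_sub_right hT hq hc
  have hc' := hc
  rw [← h4] at hcp
  obtain ⟨t, ht, rfl⟩ := hcp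
  have hle : t ≤ s := le_csSup hSb ⟨ht, hcL⟩
  have e := dist_of_mem_seg hT hc
  have e1 := h1 t ht _ hD
  have e2 := h1 s hsI _ hD
  rw [h3, abs_of_nonpos (by linarith [ht.2])] at e1
  rw [h3, abs_of_nonpos (by linarith [hsI.2])] at e2
  have : dist (γ s) (γ t) ≤ 0 := by linarith
  exact (dist_le_zero.1 this).symm

theorem weakHomeo_seg {T : Type*} [MetricSpace T] (hT : IsRTree T) {f : T → T}
    (hf : IsWeakHomeo f) {x y z : T} : f x ∈ seg (f y) (f z) ↔ x ∈ seg y z := by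
  have hi := hf.1.1
  by_cases h1 : x = y
  · subst h1
    simp only [left_mem_seg hT]
  by_cases h2 : x = z
  · subst h2
    simp only [right_mem_seg hT]
  have := hf.2 x y z
  unfold Btwn at this
  constructor
  · intro h
    exact (this.2 ⟨h, hi.ne h1, hi.ne h2⟩).1
  · intro h
    exact (this.1 ⟨h, h1, h2⟩).1

/-- For a non-nesting action by weak homeomorphisms on an `ℝ`-tree,
if `g` is loxodromic with axis `L`, then for every `p` the segment `[p, g p]` meets
`L`, and `[p, g p] ∩ L = [q, g q]` for some `q ∈ L`. -/
theorem seg_inter_axis_of_loxodromic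
    {T : Type*} [MetricSpace T] (hT : IsRTree T)
    {G : Type*} [Group G] [MulAction G T]
    (hact : ActsByWeakHomeos G T) (hnn : NonNesting G T)
    (g : G) (hg : ¬ ∃ t : T, g • t = t) (L : Set T) (hL : IsAxis g L) :
    ∀ p : T, (seg p (g • p) ∩ L).Nonempty ∧
      ∃ q ∈ L, seg p (g • p) ∩ L = seg q (g • q) := by
  intro p
  obtain ⟨hline, hinv⟩ := hL
  obtain ⟨q, hqL, hq⟩ := exists_proj hT hline p
  have hgqL : g • q ∈ L := by
    rw [← hinv]; exact ⟨q, hqL, rfl⟩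
  have hne : q ≠ g • q := fun h => hg ⟨q, h.symm⟩
  have hgq : ∀ c ∈ seg (g • p) (g • q), c ∈ L → c = g • q := by
    intro c hc hcL
    rw [← hinv] at hcL
    obtain ⟨d, hd, rfl⟩ := hcL
    have : d ∈ seg p q := (weakHomeo_seg hT (hact g)).1 hc
    simp only
    rw [hq d this hd]
  have hsub : seg q (g • q) ⊆ L := hline.1 q hqL _ hgqL
  -- `q` lies on `[p, g q]`
  have k1 : q ∈ seg p (g • q) :=
    mem_seg_of_inter hT fun c h1 h2 => hq c h1 (hsub h2)
  have k2 : g • q ∈ seg p (g • p) := by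
    apply mem_seg_of_inter hT
    intro c h1 h2
    rw [seg_symm hT] at h2
    rcases seg_split hT h1 k1 with h | h
    · exfalso
      have h3 : q ∈ seg c (g • q) := seg_swap hT k1 h
      exact hne (hgq q (seg_sub_right hT h2 h3) hqL)
    · exact hgq c h2 (hsub h)
  refine ⟨⟨g • q, k2, hgqL⟩, q, hqL, ?_⟩
  ext c
  constructor
  · rintro ⟨h1, h2⟩
    rcases seg_split hT h1 k2 with h | h
    · rcases seg_split hT h k1 with h' | h'
      · rw [hq c h' h2]; exact left_mem_seg hT _ _
      · exact h'
    · rw [seg_symm hT] at h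
      rw [hgq c h h2]; exact right_mem_seg hT _ _
  · intro h
    exact ⟨seg_sub_left hT k2 (seg_sub_right hT k1 h), hsub h⟩
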